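/- arXiv:2406.17585 — 3 statements merged into one kernel-verified Lean document; each statement's English description precedes it below -/
import Mathlib

section
/- Let d ≥ 1, μ > 0 a real number, and W a d×d real matrix with Hadamard square W ⊙ W, (W ⊙ W) i j = (W i j)². Then trace((I + μ·(W ⊙ W))^d) ≥ d, and trace((I + μ·(W ⊙ W))^d) = d if and only if the support digraph of W is acyclic. -/
open Matrix

/-- A directed cycle for a relation `r` on `Fin d`. -/
def HasCycle {d : ℕ} (r : Fin d → Fin d → Prop) : Prop :=
  ∃ (m : ℕ) (v : ℕ → Fin d), 1 ≤ m ∧ v m = v 0 ∧ ∀ l < m, r (v l) (v (l + 1))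

theorem Matrix.pow_entry_nonneg {n : Type*} [Fintype n] [DecidableEq n] {A : Matrix n n ℝ}
    (hA : ∀ i j, 0 ≤ A i j) (k : ℕ) (i j : n) : 0 ≤ (A ^ k) i j := by
  induction k generalizing j with
  | zero => rw [pow_zero, Matrix.one_apply]; split_ifs <;> norm_num
  | succ k ih =>
    rw [pow_succ, Matrix.mul_apply]
    exact Finset.sum_nonneg fun x _ => mul_nonneg (ih x) (hA x j)

theorem Matrix.pow_entry_pos_of_walk {n : Type*} [Fintype n] [DecidableEq n] {A : Matrix n n ℝ}
    (hA : ∀ i j, 0 ≤ A i j) (v : ℕ → n) (k : ℕ) (hv : ∀ l < k, A (v l) (v (l + 1)) ≠ 0) :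
    0 < (A ^ k) (v 0) (v k) := by
  induction k with
  | zero => simp
  | succ k ih =>
    rw [pow_succ, Matrix.mul_apply]
    refine Finset.sum_pos' (fun x _ => mul_nonneg (pow_entry_nonneg hA k _ x) (hA x _))
      ⟨v k, Finset.mem_univ _, mul_pos (ih fun l hl => hv l (by lia)) ?_⟩
    exact (hA _ _).lt_of_ne' (hv k k.lt_succ_self)

theorem Matrix.exists_walk_of_pow_entry_ne_zero {n R : Type*} [Fintype n] [DecidableEq n]
    [Semiring R] {A : Matrix n n R} (k : ℕ) {i j : n} (h : (A ^ k) i j ≠ 0) :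
    ∃ v : ℕ → n, v 0 = i ∧ v k = j ∧ ∀ l < k, A (v l) (v (l + 1)) ≠ 0 := by
  induction k generalizing j with
  | zero =>
    have hij : i = j := by
      by_contra hne
      exact h (by rw [pow_zero, Matrix.one_apply_ne hne])
    exact ⟨fun _ => i, rfl, hij, fun l hl => absurd hl l.not_lt_zero⟩
  | succ k ih =>
    rw [pow_succ, Matrix.mul_apply] at h
    obtain ⟨x, -, hx⟩ := Finset.exists_ne_zero_of_sum_ne_zero h
    obtain ⟨v, h0, hk, hv⟩ := ih (left_ne_zero_of_mul hx)
    refine ⟨fun l => if l ≤ k then v l else j, by simpa using h0, by simp, fun l hl => ?_⟩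
    rcases (Nat.lt_succ_iff.mp hl).lt_or_eq with hlk | rfl
    · simpa [hlk.le, Nat.succ_le_iff.mpr hlk] using hv l hlk
    · simpa [hk] using right_ne_zero_of_mul hx

theorem Matrix.trace_one_add_pow {n R : Type*} [Fintype n] [DecidableEq n] [CommSemiring R]
    (A : Matrix n n R) (k : ℕ) :
    ((1 + A) ^ k).trace =
      ∑ m ∈ Finset.range k, (k.choose (m + 1) : R) * (A ^ (m + 1)).trace + Fintype.card n := by
  have hterm (m : ℕ) : (A ^ m * (k.choose m : Matrix n n R)).trace =
      (k.choose m : R) * (A ^ m).trace := by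
    rw [← nsmul_eq_mul', Matrix.trace_smul, nsmul_eq_mul]
  rw [add_comm, (Commute.one_right A).add_pow, Matrix.trace_sum]
  simp only [one_pow, mul_one, hterm]
  rw [Finset.sum_range_succ']
  simp

theorem HasCycle.exists_length_le {d : ℕ} {r : Fin d → Fin d → Prop} (h : HasCycle r) :
    ∃ (m : ℕ) (v : ℕ → Fin d), 1 ≤ m ∧ m ≤ d ∧ v m = v 0 ∧ ∀ l < m, r (v l) (v (l + 1)) := by
  obtain ⟨m, v, hm, hclosed, hr⟩ := h
  induction m using Nat.strong_induction_on generalizing v with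
  | _ m ih =>
    by_cases hmd : m ≤ d
    · exact ⟨m, v, hm, hmd, hclosed, hr⟩
    have hnot : ¬ Function.Injective fun i : Fin m => v i := fun hinj =>
      hmd (by simpa using Fintype.card_le_of_injective _ hinj)
    obtain ⟨i, j, hij, hlt⟩ : ∃ i j : Fin m, v i = v j ∧ i < j := by
      simp only [Function.Injective, not_forall] at hnot
      obtain ⟨i, j, hij, hne⟩ := hnot
      rcases lt_or_gt_of_ne hne with hlt | hlt
      · exact ⟨i, j, hij, hlt⟩
      · exact ⟨j, i, hij.symm, hlt⟩
    have hlt' : (i : ℕ) < j := hlt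
    refine ih (j - i) (by lia) (fun l => v (i + l)) (by lia) ?_ fun l hl => hr (i + l) (by lia)
    simp only [Nat.add_sub_cancel' hlt'.le, add_zero, hij]

/-- Validity of the polynomial acyclicity constraint: for `μ > 0` and the Hadamard
square `W ⊙ W`, `tr ((I + μ (W ⊙ W))^d) ≥ d`, with equality iff the support digraph
of `W` (edge `i → j` iff `W i j ≠ 0`) is acyclic. -/
theorem trace_poly_hadamard_sq (d : ℕ) (hd : 1 ≤ d) (μ : ℝ) (hμ : 0 < μ)
    (W : Matrix (Fin d) (Fin d) ℝ) :
    (d : ℝ) ≤ ((1 + μ • (Matrix.of fun i j => (W i j) ^ 2)) ^ d).trace ∧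
      (((1 + μ • (Matrix.of fun i j => (W i j) ^ 2)) ^ d).trace = d ↔
        ¬ HasCycle (fun i j => W i j ≠ 0)) := by
  set A : Matrix (Fin d) (Fin d) ℝ := μ • Matrix.of fun i j => (W i j) ^ 2 with hAdef
  have hA (i j) : 0 ≤ A i j := mul_nonneg hμ.le (sq_nonneg (W i j))
  have hsupp (i j) : A i j ≠ 0 ↔ W i j ≠ 0 := by simp [hAdef, hμ.ne']
  have htrace (k : ℕ) : 0 ≤ (A ^ k).trace :=
    Finset.sum_nonneg fun i _ => Matrix.pow_entry_nonneg hA k i i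
  have hterm (m : ℕ) (_ : m ∈ Finset.range d) :
      0 ≤ (d.choose (m + 1) : ℝ) * (A ^ (m + 1)).trace :=
    mul_nonneg (Nat.cast_nonneg _) (htrace _)
  rw [Matrix.trace_one_add_pow, Fintype.card_fin]
  refine ⟨le_add_of_nonneg_left (Finset.sum_nonneg hterm), ?_⟩
  rw [add_eq_right, Finset.sum_eq_zero_iff_of_nonneg hterm]
  constructor
  · intro hzero hcycle
    obtain ⟨m, v, hm, hmd, hclosed, hv⟩ := hcycle.exists_length_le
    obtain ⟨k, rfl⟩ := Nat.exists_eq_add_of_le' hm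
    have hpos := Matrix.pow_entry_pos_of_walk hA v (k + 1) fun l hl => (hsupp _ _).2 (hv l hl)
    rw [hclosed] at hpos
    have htr : 0 < (A ^ (k + 1)).trace :=
      Finset.sum_pos' (fun i _ => Matrix.pow_entry_nonneg hA (k + 1) i i)
        ⟨v 0, Finset.mem_univ _, hpos⟩
    have hchoose : (0 : ℝ) < d.choose (k + 1) := Nat.cast_pos.2 (Nat.choose_pos hmd)
    exact (mul_pos hchoose htr).ne' (hzero k (Finset.mem_range.2 hmd))
  · intro hacyclic m _
    refine mul_eq_zero_of_right _ (Finset.sum_eq_zero fun i _ => ?_)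
    by_contra hne
    obtain ⟨v, h0, hm, hv⟩ := Matrix.exists_walk_of_pow_entry_ne_zero (m + 1) hne
    exact hacyclic ⟨m + 1, v, m.succ_pos, hm.trans h0.symm, fun l hl => (hsupp _ _).1 (hv l hl)⟩
end

section
/- Let d ≥ 1 and A a d×d real matrix with A i j ≥ 0 for all i, j. Then the support digraph of A is acyclic if and only if the characteristic polynomial of A equals X^d (equivalently, A is nilpotent, equivalently every complex eigenvalue of A is 0). -/
open Matrix Polynomial

theorem pow_apply_pos_of_walk {n R : Type*} [Fintype n] [DecidableEq n] [Semiring R]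
    [PartialOrder R] [IsStrictOrderedRing R] {A : Matrix n n R} (hA : ∀ i j, 0 ≤ A i j)
    {u : ℕ → n} (hu : ∀ l, A (u l) (u (l + 1)) ≠ 0) (k : ℕ) : 0 < (A ^ k) (u 0) (u k) := by
  have hpow : ∀ k i j, 0 ≤ (A ^ k) i j := by
    intro k
    induction k with
    | zero =>
      intro i j
      rw [pow_zero, Matrix.one_apply]
      split_ifs
      exacts [zero_le_one, le_rfl]
    | succ k ih =>
      intro i j
      rw [pow_succ, Matrix.mul_apply]
      exact Finset.sum_nonneg fun x _ => mul_nonneg (ih i x) (hA x j)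
  induction k with
  | zero => simp
  | succ k ih =>
    rw [pow_succ, Matrix.mul_apply]
    exact Finset.sum_pos' (fun x _ => mul_nonneg (hpow k _ x) (hA x _))
      ⟨u k, Finset.mem_univ _, mul_pos ih ((hA _ _).lt_of_ne' (hu k))⟩

theorem exists_walk_of_pow_apply_ne_zero {n R : Type*} [Fintype n] [DecidableEq n] [Semiring R]
    {A : Matrix n n R} (k : ℕ) {i j : n} (h : (A ^ k) i j ≠ 0) :
    ∃ v : ℕ → n, v k = j ∧ ∀ l < k, A (v l) (v (l + 1)) ≠ 0 := by
  induction k generalizing j with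
  | zero => exact ⟨fun _ => j, rfl, by simp⟩
  | succ k ih =>
    rw [pow_succ, Matrix.mul_apply] at h
    obtain ⟨x, -, hx⟩ := Finset.exists_ne_zero_of_sum_ne_zero h
    obtain ⟨v, hvk, hv⟩ := ih (left_ne_zero_of_mul hx)
    refine ⟨fun l => if l ≤ k then v l else j, by simp, fun l hl => ?_⟩
    rcases (Nat.lt_succ_iff.mp hl).lt_or_eq with hlk | rfl
    · simpa [hlk.le, Nat.succ_le_iff.mpr hlk] using hv l hlk
    · simpa [hvk] using right_ne_zero_of_mul hx

theorem HasCycle.exists_infinite_walk {d : ℕ} {r : Fin d → Fin d → Prop} (h : HasCycle r) :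
    ∃ u : ℕ → Fin d, ∀ l, r (u l) (u (l + 1)) := by
  obtain ⟨m, v, hm, hv, hr⟩ := h
  refine ⟨fun l => v (l % m), fun l => ?_⟩
  have hlt : l % m < m := Nat.mod_lt _ hm
  have hstep : v ((l + 1) % m) = v (l % m + 1) := by
    rw [← Nat.mod_add_mod]
    rcases (Nat.succ_le_iff.mpr hlt).lt_or_eq with h | h
    · rw [Nat.mod_eq_of_lt h]
    · rw [show l % m + 1 = m from h, Nat.mod_self, hv]
  change r (v (l % m)) (v ((l + 1) % m))
  rw [hstep]
  exact hr _ hlt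

theorem HasCycle.of_walk {d : ℕ} {r : Fin d → Fin d → Prop} {v : ℕ → Fin d}
    (hv : ∀ l < d, r (v l) (v (l + 1))) : HasCycle r := by
  obtain ⟨a, b, hab, heq⟩ :=
    Fintype.exists_ne_map_eq_of_card_lt (fun l : Fin (d + 1) => v l) (by simp)
  wlog hlt : a < b generalizing a b
  · exact this b a hab.symm heq.symm (hab.lt_or_gt.resolve_left hlt)
  have hlt' : (a : ℕ) < b := hlt
  have hb := b.isLt
  refine ⟨b - a, fun l => v (a + l), by omega, ?_, fun l hl => hv _ (by omega)⟩
  simpa [Nat.add_sub_cancel' hlt'.le] using heq.symm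

theorem Matrix.charpoly_eq_X_pow_card_iff_isNilpotent {n R : Type*} [Fintype n] [DecidableEq n]
    [CommRing R] [IsDomain R] {A : Matrix n n R} :
    A.charpoly = X ^ Fintype.card n ↔ IsNilpotent A := by
  refine ⟨fun h => ⟨Fintype.card n, ?_⟩, fun h => ?_⟩
  · simpa [h] using A.aeval_self_charpoly
  · exact sub_eq_zero.mp (Matrix.isNilpotent_charpoly_sub_pow_of_isNilpotent h).eq_zero

/-- Spectral (NO BEARS) characterization: for an entrywise-nonnegative matrix `A`,
the support digraph of `A` is acyclic iff the characteristic polynomial of `A`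
equals `X ^ d`. -/
theorem acyclic_iff_charpoly_eq_X_pow (d : ℕ) (hd : 1 ≤ d)
    (A : Matrix (Fin d) (Fin d) ℝ) (hA : ∀ i j, 0 ≤ A i j) :
    ¬ HasCycle (fun i j => A i j ≠ 0) ↔ A.charpoly = X ^ d := by
  have hchar := Matrix.charpoly_eq_X_pow_card_iff_isNilpotent (A := A)
  rw [Fintype.card_fin] at hchar
  rw [hchar]
  constructor
  · refine fun h => ⟨d, ?_⟩
    ext i j
    by_contra hij
    obtain ⟨v, -, hv⟩ := exists_walk_of_pow_apply_ne_zero d hij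
    exact h (HasCycle.of_walk hv)
  · rintro ⟨k, hk⟩ h
    obtain ⟨u, hu⟩ := h.exists_infinite_walk
    simpa [hk] using pow_apply_pos_of_walk hA hu k
end

section
/- Let d ≥ 1, p : Fin d → ℝ, and U a d×d real matrix. Define the matrix M by M i j = U i j · max (p j − p i) 0. Then the support digraph of M is acyclic. -/
/-- A relation along which a real potential strictly increases has no directed cycle. -/
theorem not_hasCycle_of_potential_lt {d : ℕ} {r : Fin d → Fin d → Prop} (p : Fin d → ℝ)
    (h : ∀ i j, r i j → p i < p j) : ¬ HasCycle r := by
  rintro ⟨m, v, hm, hv, hr⟩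
  have increasing : ∀ n, 1 ≤ n → n ≤ m → p (v 0) < p (v n) := by
    intro n hn
    induction n, hn using Nat.le_induction with
    | base => exact fun hle => h _ _ (hr 0 hle)
    | succ n _ ih => exact fun hle => (ih (by lia)).trans (h _ _ (hr n hle))
  exact (increasing m hm le_rfl).ne (congrArg p hv.symm)

/-- Correctness of the DAGS-with-NOCURL parametrization: the matrix
`M i j = U i j * max (p j - p i) 0` always has an acyclic support digraph. -/
theorem nocurl_acyclic (d : ℕ) (hd : 1 ≤ d) (p : Fin d → ℝ)
    (U : Matrix (Fin d) (Fin d) ℝ) :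
    ¬ HasCycle (fun i j => (Matrix.of fun i j => U i j * max (p j - p i) 0) i j ≠ 0) := by
  refine not_hasCycle_of_potential_lt p fun i j hij => ?_
  by_contra! hle
  exact hij (by simp [max_eq_right (sub_nonpos.mpr hle)])
end
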